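/- arXiv:2412.00635 — 2 statements merged into one kernel-verified Lean document; each statement's English description precedes it below -/
import Mathlib

section
/- Let G be a quasi-transitive d-regular locally finite, connected, infinite simple graph. Then p_c(G) ≥ 1/(d-1), and equality p_c(G) = 1/(d-1) holds if and only if G is a tree (i.e. G contains no cycle). -/
open MeasureTheory
open scoped Classical ENNReal

/-- The Bernoulli measure on `Bool` with parameter `p` (`true` = open, with prob. `p`). -/
noncomputable def bernoulliMeasure (p : ℝ) : Measure Bool :=
  ENNReal.ofReal p • Measure.dirac true + ENNReal.ofReal (1 - p) • Measure.dirac false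

/-- The Bernoulli(`p`) product measure on configurations `ι → Bool`, realized as the
Carathéodory-extension outer measure of the product premeasure; on measurable sets it
is the usual i.i.d. Bernoulli product probability measure. -/
noncomputable def bernoulliProduct (ι : Type*) (p : ℝ) : OuterMeasure (ι → Bool) :=
  OuterMeasure.ofFunction
    (fun A : Set (ι → Bool) =>
      if A = ∅ then 0 else ∏' i : ι, bernoulliMeasure p (Function.eval i '' A))
    (by simp)

/-- The subgraph of open edges of the configuration `ω` (an edge `e` is open iff `ω e = true`). -/
def openSubgraph {V : Type*} (G : SimpleGraph V) (ω : G.edgeSet → Bool) : SimpleGraph V :=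
  G.deleteEdges {e : Sym2 V | ∃ h : e ∈ G.edgeSet, ω ⟨e, h⟩ = false}

/-- The event that the open subgraph has an infinite connected component. -/
def HasInfiniteCluster {V : Type*} (G : SimpleGraph V) (ω : G.edgeSet → Bool) : Prop :=
  ∃ v : V, {w : V | (openSubgraph G ω).Reachable v w}.Infinite

/-- The critical percolation threshold
`p_c(G) = sup {p ∈ [0,1] | ℙ_p(∃ an infinite connected component) = 0}`. -/
noncomputable def pc {V : Type*} (G : SimpleGraph V) : ℝ :=
  sSup {p : ℝ | p ∈ Set.Icc (0 : ℝ) 1 ∧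
    bernoulliProduct G.edgeSet p {ω | HasInfiniteCluster G ω} = 0}

/-- A graph is quasi-transitive if its automorphism group acts on the vertices with
finitely many orbits, i.e. there is a finite set meeting every orbit. -/
def QuasiTransitive {V : Type*} (G : SimpleGraph V) : Prop :=
  ∃ S : Finset V, ∀ v : V, ∃ φ : G ≃g G, φ v ∈ S

section BernoulliProduct

lemma hasProd_iInf_of_le_one {ι : Type*} {g : ι → ℝ≥0∞} (hg : ∀ i, g i ≤ 1) :
    HasProd g (⨅ s : Finset ι, ∏ i ∈ s, g i) :=
  hasProd_of_isGLB_of_le_one _ hg isGLB_iInf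

lemma isProbabilityMeasure_bernoulliMeasure {p : ℝ} (h0 : 0 ≤ p) (h1 : p ≤ 1) :
    IsProbabilityMeasure (bernoulliMeasure p) := by
  constructor
  simp only [bernoulliMeasure, Measure.coe_add, Measure.coe_smul, Pi.add_apply, Pi.smul_apply,
    measure_univ, smul_eq_mul, mul_one]
  rw [← ENNReal.ofReal_add h0 (by linarith)]
  simp

lemma bernoulliMeasure_singleton_true (p : ℝ) :
    bernoulliMeasure p {true} = ENNReal.ofReal p := by
  simp [bernoulliMeasure]

lemma bernoulliProduct_forall_eq_true_le {ι : Type*} {p : ℝ} (h0 : 0 ≤ p) (h1 : p ≤ 1)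
    (F : Finset ι) :
    bernoulliProduct ι p {ω | ∀ i ∈ F, ω i = true} ≤ ENNReal.ofReal p ^ F.card := by
  have := isProbabilityMeasure_bernoulliMeasure h0 h1
  refine (OuterMeasure.ofFunction_le _).trans ?_
  split_ifs
  · simp
  rw [(hasProd_iInf_of_le_one fun i => prob_le_one).tprod_eq]
  refine (iInf_le _ F).trans ?_
  rw [← Finset.prod_const]
  refine Finset.prod_le_prod' fun i hi => ?_
  rw [← bernoulliMeasure_singleton_true]
  refine measure_mono ?_
  rintro _ ⟨ω, hω, rfl⟩
  exact hω i hi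

lemma infinitePi_le_bernoulliProduct {ι : Type*} {p : ℝ}
    [IsProbabilityMeasure (bernoulliMeasure p)] (A : Set (ι → Bool)) :
    Measure.infinitePi (fun _ : ι => bernoulliMeasure p) A ≤ bernoulliProduct ι p A := by
  set μ := Measure.infinitePi (fun _ : ι => bernoulliMeasure p)
  suffices h : μ.toOuterMeasure ≤ bernoulliProduct ι p from h A
  refine OuterMeasure.le_ofFunction.2 fun s => ?_
  split_ifs with hs
  · simp [hs]
  rw [(hasProd_iInf_of_le_one fun i => prob_le_one).tprod_eq]
  refine le_iInf fun F => ?_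
  rw [← Measure.infinitePi_pi (μ := fun _ : ι => bernoulliMeasure p)
    (fun i _ => MeasurableSet.of_discrete)]
  exact measure_mono fun ω hω i _ => ⟨ω, hω, rfl⟩

lemma infinitePi_forall_eq_true {ι : Type*} {p : ℝ} (h0 : 0 ≤ p)
    [IsProbabilityMeasure (bernoulliMeasure p)] (F : Finset ι) :
    (Measure.infinitePi (fun _ : ι => bernoulliMeasure p)).real {ω | ∀ i ∈ F, ω i = true}
      = p ^ F.card := by
  have : {ω : ι → Bool | ∀ i ∈ F, ω i = true} = Set.pi F (fun _ => {true}) := by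
    ext; simp
  rw [this, measureReal_def, Measure.infinitePi_pi _ (fun i _ => MeasurableSet.of_discrete)]
  simp [bernoulliMeasure_singleton_true, h0]

lemma measurableSet_forall_eq_true {ι : Type*} (F : Finset ι) :
    MeasurableSet {ω : ι → Bool | ∀ i ∈ F, ω i = true} := by
  have : {ω : ι → Bool | ∀ i ∈ F, ω i = true} = Set.pi F (fun _ => {true}) := by
    ext; simp
  rw [this]
  exact MeasurableSet.pi F.countable_toSet fun i _ => MeasurableSet.of_discrete

end BernoulliProduct

section NonBacktracking

variable {V : Type*}

/-- `NonBacktracking G a b l`: the list `a :: b :: l` continues the step from `a` to `b` by a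
non-backtracking walk of `G` through the vertices of `l`. -/
def NonBacktracking (G : SimpleGraph V) : V → V → List V → Prop
  | _, _, [] => True
  | a, b, c :: l => G.Adj b c ∧ c ≠ a ∧ NonBacktracking G b c l

/-- The last two entries of the list `a :: b :: l`. -/
def lastStep : V → V → List V → V × V
  | a, b, [] => (a, b)
  | _, b, c :: l => lastStep b c l

/-- The edges between consecutive entries of `b :: l`. -/
def chainEdges : V → List V → List (Sym2 V)
  | _, [] => []
  | b, c :: l => s(b, c) :: chainEdges c l

variable {G H : SimpleGraph V}

lemma lastStep_append (a b : V) (l l' : List V) :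
    lastStep a b (l ++ l') = lastStep (lastStep a b l).1 (lastStep a b l).2 l' := by
  induction l generalizing a b with
  | nil => rfl
  | cons c l ih => exact ih b c

lemma nonBacktracking_append {a b : V} {l l' : List V} :
    NonBacktracking G a b (l ++ l') ↔ NonBacktracking G a b l ∧
      NonBacktracking G (lastStep a b l).1 (lastStep a b l).2 l' := by
  induction l generalizing a b with
  | nil => simp [NonBacktracking, lastStep]
  | cons c l ih => simp [NonBacktracking, lastStep, ih, and_assoc]

lemma NonBacktracking.mono (h : H ≤ G) {a b : V} {l : List V} (hl : NonBacktracking H a b l) :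
    NonBacktracking G a b l := by
  induction l generalizing a b with
  | nil => trivial
  | cons c l ih => exact ⟨h hl.1, hl.2.1, ih hl.2.2⟩

lemma NonBacktracking.adj_lastStep {a b : V} {l : List V} (hab : G.Adj a b)
    (hl : NonBacktracking G a b l) : G.Adj (lastStep a b l).1 (lastStep a b l).2 := by
  induction l generalizing a b with
  | nil => exact hab
  | cons c l ih => exact ih hl.1 hl.2.2

lemma lastStep_suffix (a b : V) (l l' : List V) :
    (lastStep a b l).1 :: (lastStep a b l).2 :: l' <:+ a :: b :: (l ++ l') := by
  induction l generalizing a b with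
  | nil => exact List.suffix_rfl
  | cons c l ih => exact (ih b c).trans (List.suffix_cons _ _)

lemma lastStep_snd_mem (a b : V) {l : List V} (hl : l ≠ []) : (lastStep a b l).2 ∈ l := by
  induction l generalizing a b with
  | nil => exact absurd rfl hl
  | cons c l ih =>
    rcases eq_or_ne l [] with rfl | h
    · simp [lastStep]
    · exact List.mem_cons_of_mem _ (ih b c h)

lemma length_chainEdges (b : V) (l : List V) : (chainEdges b l).length = l.length := by
  induction l generalizing b with
  | nil => rfl
  | cons c l ih => simp [chainEdges, ih]

lemma mem_of_mem_chainEdges {b x : V} {l : List V} {e : Sym2 V} (he : e ∈ chainEdges b l)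
    (hx : x ∈ e) : x ∈ b :: l := by
  induction l generalizing b with
  | nil => simp [chainEdges] at he
  | cons c l ih =>
    simp only [chainEdges, List.mem_cons] at he
    rcases he with rfl | he
    · simp only [Sym2.mem_iff] at hx
      rcases hx with rfl | rfl <;> simp
    · exact List.mem_cons_of_mem _ (ih he)

lemma nodup_chainEdges {b : V} {l : List V} (h : (b :: l).Nodup) : (chainEdges b l).Nodup := by
  induction l generalizing b with
  | nil => simp [chainEdges]
  | cons c l ih =>
    rw [List.nodup_cons] at h
    refine List.nodup_cons.2 ⟨fun he => h.1 ?_, ih h.2⟩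
    exact mem_of_mem_chainEdges he (Sym2.mem_mk_left b c)

lemma NonBacktracking.chainEdges_subset {a b : V} {l : List V} (h : NonBacktracking G a b l) :
    ∀ e ∈ chainEdges b l, e ∈ G.edgeSet := by
  induction l generalizing a b with
  | nil => simp [chainEdges]
  | cons c l ih =>
    intro e he
    simp only [chainEdges, List.mem_cons] at he
    rcases he with rfl | he
    · exact h.1
    · exact ih h.2.2 e he

lemma nonBacktracking_tail_support {x y : V} {q : G.Walk x y} (hq : q.IsPath) {a : V}
    (ha : s(a, x) ∉ q.edges) : NonBacktracking G a x q.support.tail := by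
  induction q generalizing a with
  | nil => trivial
  | @cons x c y h q ih =>
    rw [SimpleGraph.Walk.cons_isPath_iff] at hq
    rw [SimpleGraph.Walk.support_cons, List.tail_cons, ← SimpleGraph.Walk.cons_tail_support]
    refine ⟨h, ?_, ih hq.1 fun hm => hq.2 (q.fst_mem_support_of_mem_edges hm)⟩
    rintro rfl
    simp [Sym2.eq_swap] at ha

lemma lastStep_tail_support (a : V) {x y : V} (q : G.Walk x y) :
    (lastStep a x q.support.tail).2 = y := by
  induction q generalizing a with
  | nil => rfl
  | @cons x c y h q ih =>
    rw [SimpleGraph.Walk.support_cons, List.tail_cons, ← SimpleGraph.Walk.cons_tail_support]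
    exact ih x

/-- A cycle through `c` can be followed without backtracking after any step into `c`. -/
lemma exists_nonBacktracking_of_isCycle {a c : V} {p : G.Walk c c} (hp : p.IsCycle) :
    ∃ l, l.length = p.length ∧ NonBacktracking G a c l ∧ (lastStep a c l).2 = c := by
  have key : ∀ p : G.Walk c c, p.IsCycle → p.snd ≠ a →
      ∃ l, l.length = p.length ∧ NonBacktracking G a c l ∧ (lastStep a c l).2 = c := by
    intro p hp ha
    refine ⟨p.support.tail, by simp, ?_, lastStep_tail_support a p⟩
    cases p with
    | nil => exact absurd rfl hp.ne_nil
    | @cons _ b _ h q =>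
      rw [SimpleGraph.Walk.cons_isCycle_iff] at hp
      rw [SimpleGraph.Walk.support_cons, List.tail_cons, ← SimpleGraph.Walk.cons_tail_support]
      exact ⟨h, by simpa using ha, nonBacktracking_tail_support hp.1 hp.2⟩
  by_cases ha : p.snd = a
  · obtain ⟨l, h⟩ := key p.reverse hp.reverse
      (by rw [SimpleGraph.Walk.snd_reverse, ← ha]; exact hp.snd_ne_penultimate.symm)
    exact ⟨l, by simpa using h⟩
  · exact key p hp ha

/-- A walk shorter than a preceding non-backtracking walk is followed, after reduction, by a
non-backtracking walk with the same initial step. -/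
lemma NonBacktracking.exists_lastStep_eq {a b : V} {x c : V} (q : G.Walk x c) {l : List V}
    (hl : NonBacktracking G a b l) (hx : (lastStep a b l).2 = x) (hlen : q.length ≤ l.length) :
    ∃ l', NonBacktracking G a b l' ∧ (lastStep a b l').2 = c ∧
      l'.length ≤ l.length + q.length := by
  induction q generalizing l with
  | nil => exact ⟨l, hl, hx, by simp⟩
  | @cons x y c h q ih =>
    rw [SimpleGraph.Walk.length_cons] at hlen ⊢
    by_cases hy : y = (lastStep a b l).1
    · have hne : l ≠ [] := by rintro rfl; simp at hlen
      obtain ⟨l₀, z, rfl⟩ : ∃ l₀ z, l = l₀ ++ [z] :=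
        ⟨l.dropLast, l.getLast hne, (List.dropLast_append_getLast hne).symm⟩
      rw [nonBacktracking_append] at hl
      rw [lastStep_append] at hy
      simp only [List.length_append, List.length_singleton] at hlen ⊢
      obtain ⟨l', h1, h2, h3⟩ := ih hl.1 hy.symm (by omega)
      exact ⟨l', h1, h2, by omega⟩
    · obtain ⟨l', h1, h2, h3⟩ := ih (l := l ++ [y])
        (nonBacktracking_append.2 ⟨hl, by rw [hx]; exact h, hy, trivial⟩)
        (by rw [lastStep_append]; rfl) (by simp; omega)
      exact ⟨l', h1, h2, by simp at h3; omega⟩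

lemma exists_nonBacktracking (hdeg : ∀ v, 1 < (G.neighborSet v).ncard) (a b : V) (n : ℕ) :
    ∃ l, l.length = n ∧ NonBacktracking G a b l := by
  induction n generalizing a b with
  | zero => exact ⟨[], rfl, trivial⟩
  | succ n ih =>
    obtain ⟨c, hc, hca⟩ := Set.exists_ne_of_one_lt_ncard (hdeg b) a
    obtain ⟨l, hl, hl'⟩ := ih b c
    exact ⟨c :: l, by simp [hl], hc, hca, hl'⟩

/-- In a quasi-transitive graph with a cycle and all degrees at least two, every step extends to
a non-backtracking walk of a fixed length that visits some vertex twice. -/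
lemma exists_nonBacktracking_not_nodup (hconn : G.Connected) (hqt : QuasiTransitive G)
    (hdeg : ∀ v, 1 < (G.neighborSet v).ncard) (hcyc : ¬ G.IsAcyclic) :
    ∃ M, ∀ a b, ∃ l, l.length = M ∧ NonBacktracking G a b l ∧ ¬ (a :: b :: l).Nodup := by
  obtain ⟨S, hS⟩ := hqt
  simp only [SimpleGraph.IsAcyclic, not_forall, not_not] at hcyc
  obtain ⟨c, p, hp⟩ := hcyc
  set R := S.sup (fun s => G.dist s c) with hR
  refine ⟨2 * R + p.length, fun a b => ?_⟩
  obtain ⟨l, hl, hnb⟩ := exists_nonBacktracking hdeg a b R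
  obtain ⟨φ, hφ⟩ := hS (lastStep a b l).2
  obtain ⟨q, hq⟩ := hconn.exists_walk_length_eq_dist (φ (lastStep a b l).2) c
  have hqR : q.length ≤ R := hq ▸ Finset.le_sup (f := fun s => G.dist s c) hφ
  let q' := (q.map φ.symm.toHom).copy (φ.symm_apply_apply _) rfl
  obtain ⟨l₁, h1, h2, h3⟩ := hnb.exists_lastStep_eq q' rfl (by simp [q', hl, hqR])
  have hp' : (p.map φ.symm.toHom).IsCycle := hp.map φ.symm.injective
  obtain ⟨l₂, g1, g2, g3⟩ := exists_nonBacktracking_of_isCycle (a := (lastStep a b l₁).1) hp'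
  rw [SimpleGraph.Walk.length_map] at g1
  rw [← h2] at g2 g3
  have hlen : l₁.length + l₂.length ≤ 2 * R + p.length := by
    simp [q'] at h3; omega
  set e := lastStep a b (l₁ ++ l₂) with he
  obtain ⟨l₃, k1, k2⟩ := exists_nonBacktracking hdeg e.1 e.2
    (2 * R + p.length - (l₁.length + l₂.length))
  refine ⟨l₁ ++ l₂ ++ l₃, by simp; omega,
    nonBacktracking_append.2 ⟨nonBacktracking_append.2 ⟨h1, g2⟩, k2⟩, fun hnd => ?_⟩
  rw [List.append_assoc] at hnd
  have h4 := hnd.sublist (lastStep_suffix a b l₁ (l₂ ++ l₃)).sublist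
  have hne : l₂ ≠ [] := by
    rintro rfl
    have := hp.three_le_length
    simp at g1; omega
  have h5 := lastStep_snd_mem (lastStep a b l₁).1 (lastStep a b l₁).2 hne
  rw [g3] at h5
  simp [h5] at h4

end NonBacktracking

section UpperBound

variable {V : Type*} {G : SimpleGraph V}

lemma finite_setOf_walk_length_le (hlf : ∀ v : V, (G.neighborSet v).Finite) (v : V) (n : ℕ) :
    {w | ∃ q : G.Walk v w, q.length ≤ n}.Finite := by
  induction n generalizing v with
  | zero =>
    refine (Set.finite_singleton v).subset ?_
    rintro w ⟨q, hq⟩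
    exact (SimpleGraph.Walk.eq_of_length_eq_zero (by omega : q.length = 0)).symm
  | succ n ih =>
    refine ((Set.finite_singleton v).union ((hlf v).biUnion fun u _ => ih u)).subset ?_
    rintro w ⟨q, hq⟩
    cases q with
    | nil => exact Or.inl rfl
    | @cons _ u _ h q =>
      exact Or.inr (Set.mem_biUnion h ⟨q, by simpa using hq⟩)

lemma countable_of_connected (hconn : G.Connected) (hlf : ∀ v : V, (G.neighborSet v).Finite) :
    Countable V := by
  obtain ⟨v⟩ := hconn.nonempty
  rw [← Set.countable_univ_iff]
  refine (Set.countable_iUnion fun n => (finite_setOf_walk_length_le hlf v n).countable).mono ?_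
  intro w _
  obtain ⟨q⟩ := hconn v w
  exact Set.mem_iUnion.2 ⟨q.length, q, le_rfl⟩

/-- An infinite cluster of a locally finite graph contains arbitrarily long paths. -/
lemma exists_nonBacktracking_nodup_of_infinite {v : V}
    (hlf : ∀ v : V, (G.neighborSet v).Finite) (hv : {w | G.Reachable v w}.Infinite) (n : ℕ) :
    ∃ b l, G.Adj v b ∧ l.length = n ∧ NonBacktracking G v b l ∧ (v :: b :: l).Nodup := by
  obtain ⟨w, hw, hw'⟩ := hv.exists_notMem_finite (finite_setOf_walk_length_le hlf v n)
  obtain ⟨q, hq, hql⟩ := SimpleGraph.Reachable.exists_path_of_dist hw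
  have hlen : n < q.length := by
    by_contra h
    exact hw' ⟨q, by omega⟩
  obtain ⟨u, r, ht, htl⟩ : ∃ u, ∃ r : G.Walk v u, r.IsPath ∧ r.length = n + 1 :=
    ⟨_, q.take (n + 1), hq.take _, by rw [SimpleGraph.Walk.take_length]; omega⟩
  cases r with
  | nil => simp at htl
  | @cons _ b _ h r =>
    refine ⟨b, r.support.tail, h, by simpa using htl, ?_, ?_⟩
    · rw [SimpleGraph.Walk.cons_isPath_iff] at ht
      exact nonBacktracking_tail_support ht.1 fun hm =>
        ht.2 (r.fst_mem_support_of_mem_edges hm)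
    · rw [SimpleGraph.Walk.cons_tail_support]
      simpa using ht.support_nodup

lemma exists_nonBacktracking_nodup [Infinite V] (hconn : G.Connected)
    (hlf : ∀ v : V, (G.neighborSet v).Finite) (n : ℕ) :
    ∃ v b l, G.Adj v b ∧ l.length = n ∧ NonBacktracking G v b l ∧ (v :: b :: l).Nodup := by
  obtain ⟨v⟩ := hconn.nonempty
  refine ⟨v, exists_nonBacktracking_nodup_of_infinite hlf ?_ n⟩
  rw [Set.eq_univ_of_forall (s := {w | G.Reachable v w}) fun w => hconn v w]
  exact Set.infinite_univ

lemma exists_finset_nonBacktracking {d : ℕ} (hlf : ∀ v : V, (G.neighborSet v).Finite)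
    (hreg : ∀ v : V, (G.neighborSet v).ncard = d) (n : ℕ) {a b : V} (hab : G.Adj a b) :
    ∃ T : Finset (List V), T.card ≤ (d - 1) ^ n ∧
      ∀ l, l.length = n → NonBacktracking G a b l → l ∈ T := by
  induction n generalizing a b with
  | zero => exact ⟨{[]}, by simp, fun l hl _ => by simp [List.length_eq_zero_iff.1 hl]⟩
  | succ n ih =>
    have ih' : ∀ c, ∃ T : Finset (List V), T.card ≤ (d - 1) ^ n ∧
        (G.Adj b c → ∀ l, l.length = n → NonBacktracking G b c l → l ∈ T) := by
      intro c
      by_cases h : G.Adj b c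
      · obtain ⟨T, h1, h2⟩ := ih h
        exact ⟨T, h1, fun _ => h2⟩
      · exact ⟨∅, by simp, fun h' => absurd h' h⟩
    choose T hT hT' using ih'
    refine ⟨((hlf b).toFinset.erase a).biUnion fun c => (T c).image (c :: ·), ?_, ?_⟩
    · rw [pow_succ']
      refine (Finset.card_biUnion_le_card_mul _ _ _ fun c _ =>
        Finset.card_image_le.trans (hT c)).trans (Nat.mul_le_mul_right _ ?_)
      rw [Finset.card_erase_of_mem (by simpa using hab.symm),
        ← Set.ncard_eq_toFinset_card (G.neighborSet b) (hlf b), hreg]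
    · intro l hl hnb
      cases l with
      | nil => simp at hl
      | cons c l =>
        simp only [Finset.mem_biUnion, Finset.mem_erase, Set.Finite.mem_toFinset, Finset.mem_image]
        exact ⟨c, ⟨hnb.2.1, hnb.1⟩, l, hT' c hnb.1 l (by simpa using hl) hnb.2.2, rfl⟩

/-- `PathBound G M K`: every step of `G` extends to at most `K` paths of length `M`. -/
def PathBound (G : SimpleGraph V) (M K : ℕ) : Prop :=
  ∀ ⦃a b : V⦄, G.Adj a b → ∃ T : Finset (List V), T.card ≤ K ∧
    ∀ l, l.length = M → NonBacktracking G a b l → (a :: b :: l).Nodup → l ∈ T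

lemma PathBound.pow {M K : ℕ} (h : PathBound G M K) (k : ℕ) : PathBound G (k * M) (K ^ k) := by
  induction k with
  | zero => exact fun a b _ => ⟨{[]}, by simp, fun l hl _ _ => by simpa using hl⟩
  | succ k ih =>
    intro a b hab
    obtain ⟨T, hT, hT'⟩ := h hab
    have ih' : ∀ e : V × V, ∃ T : Finset (List V), T.card ≤ K ^ k ∧ (G.Adj e.1 e.2 →
        ∀ l, l.length = k * M → NonBacktracking G e.1 e.2 l → (e.1 :: e.2 :: l).Nodup → l ∈ T) := by
      intro e
      by_cases h : G.Adj e.1 e.2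
      · obtain ⟨T, h1, h2⟩ := ih h
        exact ⟨T, h1, fun _ => h2⟩
      · exact ⟨∅, by simp, fun h' => absurd h' h⟩
    choose U hU hU' using ih'
    refine ⟨T.biUnion fun l => (U (lastStep a b l)).image (l ++ ·), ?_, ?_⟩
    · rw [pow_succ']
      exact (Finset.card_biUnion_le_card_mul _ _ _ fun c _ =>
        Finset.card_image_le.trans (hU _)).trans (Nat.mul_le_mul_right _ hT)
    · intro l hl hnb hnd
      rw [add_mul, one_mul] at hl
      obtain ⟨l₁, l₂, rfl, h1⟩ : ∃ l₁ l₂, l = l₁ ++ l₂ ∧ l₁.length = M :=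
        ⟨l.take M, l.drop M, (List.take_append_drop M l).symm, by simp; omega⟩
      rw [nonBacktracking_append] at hnb
      simp only [Finset.mem_biUnion, Finset.mem_image]
      refine ⟨l₁, hT' l₁ h1 hnb.1 (hnd.sublist ?_), l₂,
        hU' _ (hnb.1.adj_lastStep hab) l₂ (by simp at hl; omega) hnb.2
          (hnd.sublist (lastStep_suffix a b l₁ l₂).sublist), rfl⟩
      exact ((List.sublist_append_left l₁ l₂).cons_cons b).cons_cons a

lemma openSubgraph_le (ω : G.edgeSet → Bool) : openSubgraph G ω ≤ G :=
  SimpleGraph.deleteEdges_le _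

lemma openSubgraph_adj {ω : G.edgeSet → Bool} {x y : V} :
    (openSubgraph G ω).Adj x y ↔ ∃ h : G.Adj x y, ω ⟨s(x, y), h⟩ = true := by
  simp only [openSubgraph, SimpleGraph.deleteEdges_adj, Set.mem_ofPred_eq, not_exists,
    Bool.not_eq_false]
  exact ⟨fun h => ⟨h.1, h.2 h.1⟩, fun ⟨h, h'⟩ => ⟨h, fun _ => h'⟩⟩

lemma mem_edgeSet_openSubgraph {ω : G.edgeSet → Bool} {e : Sym2 V} :
    e ∈ (openSubgraph G ω).edgeSet ↔ ∃ h : e ∈ G.edgeSet, ω ⟨e, h⟩ = true := by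
  induction e with
  | h x y => exact openSubgraph_adj

lemma bernoulliProduct_nonBacktracking_le {p : ℝ} (h0 : 0 ≤ p) (h1 : p ≤ 1) {a b : V} {l : List V}
    (hnd : (b :: l).Nodup) :
    bernoulliProduct G.edgeSet p {ω | NonBacktracking (openSubgraph G ω) a b l}
      ≤ ENNReal.ofReal p ^ l.length := by
  by_cases hG : ∀ e ∈ chainEdges b l, e ∈ G.edgeSet
  · let F : Finset G.edgeSet := ((chainEdges b l).toFinset.subtype (· ∈ G.edgeSet))
    have hF : F.card = l.length := by
      rw [Finset.card_subtype, Finset.filter_true_of_mem (by simpa using hG),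
        List.toFinset_card_of_nodup (nodup_chainEdges hnd), length_chainEdges]
    rw [← hF]
    refine (measure_mono ?_).trans (bernoulliProduct_forall_eq_true_le h0 h1 F)
    intro ω hω e he
    obtain ⟨_, h⟩ := mem_edgeSet_openSubgraph.1
      (NonBacktracking.chainEdges_subset hω e (by simpa [F] using he))
    exact h
  · have : {ω | NonBacktracking (openSubgraph G ω) a b l} = ∅ := by
      refine Set.eq_empty_of_forall_notMem fun ω hω => hG ?_
      exact (NonBacktracking.mono (openSubgraph_le ω) hω).chainEdges_subset
    simp [this]

lemma bernoulliProduct_cluster_infinite_le {p : ℝ} (h0 : 0 ≤ p) (h1 : p ≤ 1) {n K : ℕ}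
    (hlf : ∀ v : V, (G.neighborSet v).Finite) (hb : PathBound G n K) (v : V) :
    bernoulliProduct G.edgeSet p {ω | {w | (openSubgraph G ω).Reachable v w}.Infinite}
      ≤ (G.neighborSet v).ncard * (K * ENNReal.ofReal p ^ n) := by
  have hb' : ∀ b, ∃ T : Finset (List V), T.card ≤ K ∧ (G.Adj v b →
      ∀ l, l.length = n → NonBacktracking G v b l → (v :: b :: l).Nodup → l ∈ T) := by
    intro b
    by_cases h : G.Adj v b
    · obtain ⟨T, h1, h2⟩ := hb h
      exact ⟨T, h1, fun _ => h2⟩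
    · exact ⟨∅, by simp, fun h' => absurd h' h⟩
  choose T hT hT' using hb'
  let E : V → List V → Set (G.edgeSet → Bool) := fun b l =>
    {ω | l.length = n ∧ (b :: l).Nodup ∧ NonBacktracking (openSubgraph G ω) v b l}
  have hE : ∀ b l, bernoulliProduct G.edgeSet p (E b l) ≤ ENNReal.ofReal p ^ n := by
    intro b l
    by_cases h : l.length = n ∧ (b :: l).Nodup
    · rw [← h.1]
      exact (measure_mono fun ω hω => hω.2.2).trans
        (bernoulliProduct_nonBacktracking_le (a := v) h0 h1 h.2)
    · have : E b l = ∅ := Set.eq_empty_of_forall_notMem fun ω hω => h ⟨hω.1, hω.2.1⟩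
      simp [this]
  have hsub : {ω | {w | (openSubgraph G ω).Reachable v w}.Infinite}
      ⊆ ⋃ b ∈ (hlf v).toFinset, ⋃ l ∈ T b, E b l := by
    intro ω hω
    obtain ⟨b, l, hvb, hl, hnb, hnd⟩ := exists_nonBacktracking_nodup_of_infinite
      (G := openSubgraph G ω) (fun u => (hlf u).subset fun x hx => openSubgraph_le ω hx) hω n
    have hvb' : G.Adj v b := openSubgraph_le ω hvb
    refine Set.mem_biUnion (by simpa using hvb') (Set.mem_biUnion
      (hT' b hvb' l hl (hnb.mono (openSubgraph_le ω)) hnd) ⟨hl, hnd.of_cons, hnb⟩)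
  calc _ ≤ _ := measure_mono hsub
    _ ≤ ∑ b ∈ (hlf v).toFinset, bernoulliProduct G.edgeSet p (⋃ l ∈ T b, E b l) :=
        measure_biUnion_finset_le _ _
    _ ≤ ∑ _b ∈ (hlf v).toFinset, K * ENNReal.ofReal p ^ n := by
        refine Finset.sum_le_sum fun b _ => (measure_biUnion_finset_le _ _).trans ?_
        refine (Finset.sum_le_card_nsmul _ _ _ fun l _ => hE b l).trans ?_
        rw [nsmul_eq_mul]
        gcongr
        exact hT b
    _ = _ := by
        rw [Finset.sum_const, nsmul_eq_mul, ← Set.ncard_eq_toFinset_card (G.neighborSet v) (hlf v)]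

/-- If every step extends to at most `K` paths of length `M` and `K * p ^ M < 1`, there is almost
surely no infinite cluster. -/
lemma bernoulliProduct_hasInfiniteCluster_eq_zero (hconn : G.Connected)
    (hlf : ∀ v : V, (G.neighborSet v).Finite) {M K : ℕ} (hb : PathBound G M K) {p : ℝ}
    (h0 : 0 ≤ p) (h1 : p ≤ 1) (hp : K * p ^ M < 1) :
    bernoulliProduct G.edgeSet p {ω | HasInfiniteCluster G ω} = 0 := by
  have := countable_of_connected hconn hlf
  have : {ω | HasInfiniteCluster G ω}
      = ⋃ v, {ω | {w | (openSubgraph G ω).Reachable v w}.Infinite} := by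
    ext; simp [HasInfiniteCluster]
  rw [this, measure_iUnion_null_iff]
  intro v
  have hx : (K : ℝ≥0∞) * ENNReal.ofReal p ^ M < 1 := by
    rw [← ENNReal.ofReal_natCast, ← ENNReal.ofReal_pow h0, ← ENNReal.ofReal_mul (by positivity)]
    exact ENNReal.ofReal_lt_one.2 hp
  have hlim := ENNReal.Tendsto.const_mul (a := ((G.neighborSet v).ncard : ℝ≥0∞))
    (ENNReal.tendsto_pow_atTop_nhds_zero_of_lt_one hx) (Or.inr (ENNReal.natCast_ne_top _))
  rw [mul_zero] at hlim
  refine le_antisymm (ge_of_tendsto' hlim fun k => ?_) bot_le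
  refine (bernoulliProduct_cluster_infinite_le h0 h1 hlf (hb.pow k) v).trans_eq ?_
  rw [mul_pow, ← pow_mul, mul_comm k M, Nat.cast_pow]

end UpperBound

section LowerBound

/-- The second moment lower bound for the probability of a finite union of events. -/
lemma two_mul_sum_sub_le_measureReal_biUnion {Ω α : Type*} [MeasurableSpace Ω] (μ : Measure Ω)
    [IsFiniteMeasure μ] (W : Finset α) {B : α → Set Ω} (hB : ∀ w, MeasurableSet (B w)) (t : ℝ) :
    2 * t * ∑ w ∈ W, μ.real (B w) - t ^ 2 * ∑ w ∈ W, ∑ w' ∈ W, μ.real (B w ∩ B w')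
      ≤ μ.real (⋃ w ∈ W, B w) := by
  have hind : ∀ s : Set Ω, MeasurableSet s → Integrable (s.indicator (1 : Ω → ℝ)) μ :=
    fun s hs => (integrable_const (1 : ℝ)).indicator hs
  have hU : MeasurableSet (⋃ w ∈ W, B w) := W.measurableSet_biUnion fun w _ => hB w
  have h1 : Integrable (fun ω => ∑ w ∈ W, (B w).indicator (1 : Ω → ℝ) ω) μ :=
    integrable_finsetSum _ fun w _ => hind _ (hB w)
  have h2 : ∀ w, Integrable (fun ω => ∑ w' ∈ W, (B w ∩ B w').indicator (1 : Ω → ℝ) ω) μ :=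
    fun w => integrable_finsetSum _ fun w' _ => hind _ ((hB w).inter (hB w'))
  have h3 : Integrable
      (fun ω => ∑ w ∈ W, ∑ w' ∈ W, (B w ∩ B w').indicator (1 : Ω → ℝ) ω) μ :=
    integrable_finsetSum _ fun w _ => h2 w
  have key : ∫ ω, (2 * t * (∑ w ∈ W, (B w).indicator (1 : Ω → ℝ) ω)
      - t ^ 2 * ∑ w ∈ W, ∑ w' ∈ W, (B w ∩ B w').indicator (1 : Ω → ℝ) ω) ∂μ
      ≤ ∫ ω, (⋃ w ∈ W, B w).indicator (1 : Ω → ℝ) ω ∂μ := by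
    refine integral_mono ((h1.const_mul _).sub (h3.const_mul _)) (hind _ hU) fun ω => ?_
    have hsq : ∑ w ∈ W, ∑ w' ∈ W, (B w ∩ B w').indicator (1 : Ω → ℝ) ω
        = (∑ w ∈ W, (B w).indicator (1 : Ω → ℝ) ω) ^ 2 := by
      rw [sq, Finset.sum_mul_sum]
      simp only [Set.inter_indicator_one, Pi.mul_apply]
    simp only [hsq]
    by_cases hω : ω ∈ ⋃ w ∈ W, B w
    · rw [Set.indicator_of_mem hω, Pi.one_apply]
      nlinarith [sq_nonneg (1 - t * ∑ w ∈ W, (B w).indicator (1 : Ω → ℝ) ω)]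
    · rw [Set.indicator_of_notMem hω, Finset.sum_eq_zero]
      · simp
      · intro w hw
        exact Set.indicator_of_notMem (fun h => hω (Set.mem_biUnion hw h)) _
  rw [integral_indicator_one hU, integral_sub (h1.const_mul _) (h3.const_mul _),
    integral_const_mul, integral_const_mul, integral_finsetSum _ fun w _ => hind _ (hB w),
    integral_finsetSum _ fun w _ => h2 w] at key
  simp_rw [integral_indicator_one (hB _)] at key
  convert key using 4 with w
  rw [integral_finsetSum _ fun w' _ => hind _ ((hB w).inter (hB w'))]
  exact Finset.sum_congr rfl fun w' _ => (integral_indicator_one ((hB w).inter (hB w'))).symm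

/-- The words of length `n` over the alphabet `Fin b`. -/
def words (b : ℕ) : ℕ → Finset (List (Fin b))
  | 0 => {[]}
  | n + 1 => (Finset.univ ×ˢ words b n).image fun x => x.1 :: x.2

/-- The nonempty suffixes of a word. -/
def nonemptySuffixes {α : Type*} [DecidableEq α] : List α → Finset (List α)
  | [] => ∅
  | i :: w => insert (i :: w) (nonemptySuffixes w)

lemma mem_words {b n : ℕ} {w : List (Fin b)} : w ∈ words b n ↔ w.length = n := by
  induction n generalizing w with
  | zero => simp [words, List.length_eq_zero_iff]
  | succ n ih =>
    cases w with
    | nil => simp [words]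
    | cons i w => simp [words, ih]

lemma sum_words_succ {b n : ℕ} (F : List (Fin b) → ℝ) :
    ∑ w ∈ words b (n + 1), F w = ∑ i : Fin b, ∑ w ∈ words b n, F (i :: w) := by
  rw [words, Finset.sum_image, Finset.sum_product]
  rintro ⟨i, w⟩ _ ⟨j, w'⟩ _ h
  simpa using h

lemma card_words (b n : ℕ) : (words b n).card = b ^ n := by
  induction n with
  | zero => rfl
  | succ n ih =>
    rw [words, Finset.card_image_of_injective, Finset.card_product, ih, pow_succ']
    · simp
    · rintro ⟨i, w⟩ ⟨j, w'⟩ h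
      simpa using h

lemma length_le_of_mem_nonemptySuffixes {α : Type*} [DecidableEq α] {u w : List α}
    (h : u ∈ nonemptySuffixes w) : u ≠ [] ∧ u.length ≤ w.length := by
  induction w with
  | nil => simp [nonemptySuffixes] at h
  | cons i w ih =>
    simp only [nonemptySuffixes, Finset.mem_insert] at h
    rcases h with rfl | h
    · simp
    · exact ⟨(ih h).1, (ih h).2.trans (by simp)⟩

lemma card_nonemptySuffixes {α : Type*} [DecidableEq α] (w : List α) : (nonemptySuffixes w).card = w.length := by
  induction w with
  | nil => rfl
  | cons i w ih =>
    rw [nonemptySuffixes, Finset.card_insert_of_notMem, ih, List.length_cons]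
    intro h
    simpa using (length_le_of_mem_nonemptySuffixes h).2

lemma card_nonemptySuffixes_union {α : Type*} [DecidableEq α] {i j : α} {w w' : List α}
    (hlen : w.length = w'.length) (hne : i :: w ≠ j :: w') :
    (nonemptySuffixes (i :: w) ∪ nonemptySuffixes (j :: w')).card
      = (nonemptySuffixes w ∪ nonemptySuffixes w').card + 2 := by
  have h : ∀ (k : α) (v : List α), v.length = w.length →
      k :: v ∉ nonemptySuffixes w ∪ nonemptySuffixes w' := by
    intro k v hv hm
    rcases Finset.mem_union.1 hm with hm | hm
    · have := (length_le_of_mem_nonemptySuffixes hm).2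
      simp at this; omega
    · have := (length_le_of_mem_nonemptySuffixes hm).2
      simp at this; omega
  rw [nonemptySuffixes, nonemptySuffixes, Finset.insert_union, Finset.union_insert,
    Finset.card_insert_of_notMem, Finset.card_insert_of_notMem (h j w' hlen.symm)]
  rw [Finset.mem_insert]
  exact not_or.2 ⟨hne, h i w rfl⟩

lemma sum_pow_card_union_le {b : ℕ} {p : ℝ} (h0 : 0 ≤ p) (hm : 1 < b * p) (n : ℕ) :
    (b * p - 1) * ∑ w ∈ words b n, ∑ w' ∈ words b n,
      p ^ (nonemptySuffixes w ∪ nonemptySuffixes w').card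
      ≤ (b * p) ^ (2 * n + 1) - (b * p) ^ n := by
  induction n with
  | zero => simp [words, nonemptySuffixes]
  | succ n ih =>
    set m := b * p with hmdef
    set S := ∑ w ∈ words b n, ∑ w' ∈ words b n,
      p ^ (nonemptySuffixes w ∪ nonemptySuffixes w').card with hS
    have hstep : ∑ w ∈ words b (n + 1), ∑ w' ∈ words b (n + 1),
        p ^ (nonemptySuffixes w ∪ nonemptySuffixes w').card ≤ m ^ 2 * S + m ^ (n + 1) := by
      have hterm : ∀ w ∈ words b (n + 1), ∀ w' ∈ words b (n + 1),
          p ^ (nonemptySuffixes w ∪ nonemptySuffixes w').card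
          ≤ p ^ 2 * p ^ (nonemptySuffixes w.tail ∪ nonemptySuffixes w'.tail).card
            + if w = w' then p ^ (n + 1) else 0 := by
        intro w hw w' hw'
        rw [mem_words] at hw hw'
        split_ifs with h
        · subst h
          rw [Finset.union_self, card_nonemptySuffixes, hw]
          linarith [mul_nonneg (pow_nonneg h0 2)
            (pow_nonneg h0 (nonemptySuffixes w.tail ∪ nonemptySuffixes w.tail).card)]
        · obtain ⟨i, w, rfl⟩ := List.exists_cons_of_length_eq_add_one hw
          obtain ⟨j, w', rfl⟩ := List.exists_cons_of_length_eq_add_one hw'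
          rw [card_nonemptySuffixes_union (by simp at hw hw'; omega) h, add_zero, List.tail_cons,
            List.tail_cons, pow_add, mul_comm]
      refine (Finset.sum_le_sum fun w hw => Finset.sum_le_sum fun w' hw' =>
        hterm w hw w' hw').trans_eq ?_
      simp_rw [Finset.sum_add_distrib]
      congr 1
      · simp_rw [sum_words_succ, List.tail_cons]
        simp only [Finset.sum_const, Finset.card_univ, Fintype.card_fin, nsmul_eq_mul, hS, hmdef,
          Finset.mul_sum]
        simp only [← Finset.mul_sum]
        ring
      · have : ∀ w ∈ words b (n + 1),
            ∑ w' ∈ words b (n + 1), (if w = w' then p ^ (n + 1) else 0) = p ^ (n + 1) := by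
          intro w hw
          rw [Finset.sum_ite_eq, if_pos hw]
        rw [Finset.sum_congr rfl this, Finset.sum_const, card_words, nsmul_eq_mul, mul_pow,
          Nat.cast_pow]
    have hm0 : 0 ≤ m - 1 := by linarith
    calc _ ≤ (m - 1) * (m ^ 2 * S + m ^ (n + 1)) := mul_le_mul_of_nonneg_left hstep hm0
      _ = m ^ 2 * ((m - 1) * S) + (m - 1) * m ^ (n + 1) := by ring
      _ ≤ m ^ 2 * (m ^ (2 * n + 1) - m ^ n) + (m - 1) * m ^ (n + 1) := by gcongr
      _ = _ := by ring

/-- Supercritical percolation on the `b`-ary tree, with edges indexed by nonempty words, survives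
with positive probability. -/
lemma bernoulliProduct_survival_ne_zero {ι : Type*} {b : ℕ} {p : ℝ} (h0 : 0 ≤ p) (h1 : p ≤ 1)
    (hm : 1 < b * p) {e : List (Fin b) → ι} (he : Set.InjOn e {w | w ≠ []}) :
    bernoulliProduct ι p {ω | ∀ n, ∃ w : List (Fin b), w.length = n ∧
      ∀ u ∈ nonemptySuffixes w, ω (e u) = true} ≠ 0 := by
  have := isProbabilityMeasure_bernoulliMeasure h0 h1
  set μ := Measure.infinitePi (fun _ : ι => bernoulliMeasure p) with hμ
  let B : List (Fin b) → Set (ι → Bool) := fun w => {ω | ∀ u ∈ nonemptySuffixes w, ω (e u) = true}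
  let A : ℕ → Set (ι → Bool) := fun n => ⋃ w ∈ words b n, B w
  have hBF : ∀ F : Finset (List (Fin b)), {ω : ι → Bool | ∀ u ∈ F, ω (e u) = true}
      = {ω | ∀ i ∈ F.image e, ω i = true} := by
    intro F; ext ω; simp
  have hBm : ∀ w, MeasurableSet (B w) := by
    intro w
    simp only [B, hBF]
    exact measurableSet_forall_eq_true _
  have hAm : ∀ n, MeasurableSet (A n) := fun n =>
    (words b n).measurableSet_biUnion fun w _ => hBm w
  have hprob : ∀ F : Finset (List (Fin b)), (∀ u ∈ F, u ≠ []) →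
      μ.real {ω | ∀ u ∈ F, ω (e u) = true} = p ^ F.card := by
    intro F hF
    rw [hBF, hμ, infinitePi_forall_eq_true h0, Finset.card_image_of_injOn]
    exact he.mono hF
  have hlow : ∀ n, (b * p - 1) / (b * p) ≤ μ.real (A n) := by
    intro n
    have hmp : 0 < b * p := by linarith
    refine le_trans ?_ (two_mul_sum_sub_le_measureReal_biUnion μ (words b n) hBm
      ((b * p - 1) / (b * p * (b * p) ^ n)))
    have hE : ∑ w ∈ words b n, μ.real (B w) = (b * p) ^ n := by
      have : ∀ w ∈ words b n, μ.real (B w) = p ^ n := by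
        intro w hw
        rw [hprob _ fun u hu => (length_le_of_mem_nonemptySuffixes hu).1, card_nonemptySuffixes,
          mem_words.1 hw]
      rw [Finset.sum_congr rfl this, Finset.sum_const, card_words, nsmul_eq_mul, mul_pow,
        Nat.cast_pow]
    have hV : ∀ w w', μ.real (B w ∩ B w')
        = p ^ (nonemptySuffixes w ∪ nonemptySuffixes w').card := by
      intro w w'
      have : B w ∩ B w' = {ω | ∀ u ∈ nonemptySuffixes w ∪ nonemptySuffixes w', ω (e u) = true} := by
        ext ω
        simp only [B, Set.mem_inter_iff, Set.mem_ofPred_eq, Finset.mem_union, or_imp, forall_and]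
      rw [this, hprob]
      intro u hu
      rcases Finset.mem_union.1 hu with hu | hu
      exacts [(length_le_of_mem_nonemptySuffixes hu).1, (length_le_of_mem_nonemptySuffixes hu).1]
    simp_rw [hE, hV]
    have hS := sum_pow_card_union_le h0 hm n
    set S := ∑ w ∈ words b n, ∑ w' ∈ words b n,
      p ^ (nonemptySuffixes w ∪ nonemptySuffixes w').card
    set m := b * p
    have hmn : 0 < m ^ n := pow_pos hmp n
    have hS' : (m - 1) * S ≤ m * (m ^ n) ^ 2 := by
      calc _ ≤ m ^ (2 * n + 1) - m ^ n := hS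
        _ ≤ m ^ (2 * n + 1) := by linarith
        _ = _ := by ring
    have hrw : 2 * ((m - 1) / (m * m ^ n)) * m ^ n - ((m - 1) / (m * m ^ n)) ^ 2 * S
        = 2 * ((m - 1) / m) - (m - 1) / (m ^ 2 * (m ^ n) ^ 2) * ((m - 1) * S) := by
      field_simp
    have hle : (m - 1) / (m ^ 2 * (m ^ n) ^ 2) * ((m - 1) * S) ≤ (m - 1) / m := by
      calc _ ≤ (m - 1) / (m ^ 2 * (m ^ n) ^ 2) * (m * (m ^ n) ^ 2) :=
            mul_le_mul_of_nonneg_left hS' (div_nonneg (by linarith) (by positivity))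
        _ = _ := by field_simp
    rw [hrw]
    linarith
  have hanti : Antitone A := by
    refine antitone_nat_of_succ_le fun n ω hω => ?_
    simp only [A, Set.mem_iUnion, mem_words] at hω ⊢
    obtain ⟨w, hw, hB⟩ := hω
    obtain ⟨i, w, rfl⟩ := List.exists_cons_of_length_eq_add_one hw
    exact ⟨w, by simpa using hw, fun u hu => hB u (Finset.mem_insert_of_mem hu)⟩
  have hinter : {ω : ι → Bool | ∀ n, ∃ w : List (Fin b), w.length = n ∧
      ∀ u ∈ nonemptySuffixes w, ω (e u) = true} = ⋂ n, A n := by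
    ext ω
    simp [A, B, mem_words]
  have hpos : 0 < (b * p - 1) / (b * p) := div_pos (by linarith) (by linarith)
  have hge : ENNReal.ofReal ((b * p - 1) / (b * p)) ≤ μ (⋂ n, A n) := by
    rw [hanti.measure_iInter (fun n => (hAm n).nullMeasurableSet) ⟨0, measure_ne_top _ _⟩]
    refine le_iInf fun n => ?_
    rw [← ofReal_measureReal (measure_ne_top _ _)]
    exact ENNReal.ofReal_le_ofReal (hlow n)
  rw [hinter]
  exact ((ENNReal.ofReal_pos.2 hpos).trans_le
    (hge.trans (infinitePi_le_bernoulliProduct _))).ne'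

end LowerBound

section Threshold

variable {V : Type*} {G : SimpleGraph V} {d : ℕ}

/-- An acyclic `d`-regular graph contains a `(d - 1)`-ary tree. -/
lemma exists_words_embedding (hacyc : G.IsAcyclic) (hlf : ∀ v : V, (G.neighborSet v).Finite)
    (hreg : ∀ v : V, (G.neighborSet v).ncard = d) (e₀ : G.Dart) :
    ∃ f : List (Fin (d - 1)) → V, Function.Injective f ∧ ∀ i w, G.Adj (f w) (f (i :: w)) := by
  have hchild : ∀ e : G.Dart, ∃ c : Fin (d - 1) → V, Function.Injective c ∧
      ∀ i, G.Adj e.snd (c i) ∧ c i ≠ e.fst := by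
    intro e
    have hfin : Finite (G.neighborSet e.snd \ {e.fst} : Set V) := (hlf e.snd).sdiff
    have hcard : Nat.card (G.neighborSet e.snd \ {e.fst} : Set V) = d - 1 := by
      rw [Nat.card_coe_set_eq, Set.ncard_sdiff_singleton_of_mem
        (show e.fst ∈ G.neighborSet e.snd from e.adj.symm), hreg]
    let φ := Finite.equivFinOfCardEq hcard
    exact ⟨fun i => φ.symm i, Subtype.val_injective.comp φ.symm.injective,
      fun i => (φ.symm i).2⟩
  choose c hcinj hc using hchild
  let g : List (Fin (d - 1)) → G.Dart :=
    List.foldr (fun i e => ⟨(e.snd, c e i), (hc e i).1⟩) e₀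
  have hstep : ∀ (e : G.Dart) (i : Fin (d - 1)) (n : ℕ),
      (∃ q : G.Walk e₀.fst e.snd, q.IsPath ∧ q.penultimate = e.fst ∧ q.length = n) →
      ∃ q : G.Walk e₀.fst (c e i), q.IsPath ∧ q.penultimate = e.snd ∧ q.length = n + 1 := by
    rintro e i n ⟨q, hq, hpen, hlen⟩
    refine ⟨q.concat (hc e i).1, hq.concat (fun hm => (hc e i).2 ?_) _,
      SimpleGraph.Walk.penultimate_concat _ _, by simp [hlen]⟩
    rw [← hpen]
    exact hacyc.eq_penultimate_of_adj_end hq (hc e i).1 hm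
  have hbase : ∃ q : G.Walk e₀.fst e₀.snd, q.IsPath ∧ q.penultimate = e₀.fst ∧ q.length = 1 :=
    ⟨.cons e₀.adj .nil, by simp [e₀.adj.ne], rfl, rfl⟩
  have hpath : ∀ w, ∃ q : G.Walk e₀.fst (g w).snd, q.IsPath ∧ q.penultimate = (g w).fst ∧
      q.length = w.length + 1 := by
    intro w
    induction w with
    | nil => exact hbase
    | cons i w ih => exact hstep (g w) i _ ih
  have huniq : ∀ w w', (g w).snd = (g w').snd → (g w).fst = (g w').fst ∧ w.length = w'.length := by
    intro w w' h
    obtain ⟨q, hq, hpen, hlen⟩ := hpath w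
    obtain ⟨q', hq', hpen', hlen'⟩ := hpath w'
    rw [← hpen, ← hpen']
    suffices hqq : q.copy rfl h = q' by
      subst hqq
      simp only [SimpleGraph.Walk.length_copy] at hlen'
      exact ⟨by simp [SimpleGraph.Walk.penultimate], by omega⟩
    have := (hacyc.subsingleton_path e₀.fst (g w').snd).elim
      ⟨q.copy rfl h, by simpa using hq⟩ ⟨q', hq'⟩
    exact congrArg Subtype.val this
  refine ⟨fun w => (g w).snd, fun w => ?_, fun i w => (hc (g w) i).1⟩
  induction w with
  | nil =>
    intro w' h
    exact (List.length_eq_zero_iff.1 (huniq _ _ h).2.symm).symm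
  | cons i w ih =>
    intro w' h
    cases w' with
    | nil => simpa using (huniq _ _ h).2
    | cons j w' =>
      have hw : w = w' := ih (huniq _ _ h).1
      subst hw
      rw [hcinj (g w) h]

lemma bernoulliProduct_hasInfiniteCluster_ne_zero (hacyc : G.IsAcyclic)
    (hlf : ∀ v : V, (G.neighborSet v).Finite) (hreg : ∀ v : V, (G.neighborSet v).ncard = d)
    (e₀ : G.Dart) {p : ℝ} (h0 : 0 ≤ p) (h1 : p ≤ 1) (hp : 1 < ((d - 1 : ℕ) : ℝ) * p) :
    bernoulliProduct G.edgeSet p {ω | HasInfiniteCluster G ω} ≠ 0 := by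
  obtain ⟨f, hf, hadj⟩ := exists_words_embedding hacyc hlf hreg e₀
  let e : List (Fin (d - 1)) → G.edgeSet := fun w =>
    match w with
    | [] => ⟨e₀.edge, e₀.edge_mem⟩
    | i :: w => ⟨s(f w, f (i :: w)), hadj i w⟩
  have he : Set.InjOn e {w | w ≠ []} := by
    intro u hu v hv huv
    cases u with
    | nil => exact absurd rfl hu
    | cons i u =>
      cases v with
      | nil => exact absurd rfl hv
      | cons j v =>
        have h := congrArg Subtype.val huv
        simp only [e, Sym2.eq_iff] at h
        rcases h with h | h
        · exact hf h.2
        · have h2 := congrArg List.length (hf h.1)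
          have h3 := congrArg List.length (hf h.2)
          simp at h2 h3
          omega
  refine fun hzero => bernoulliProduct_survival_ne_zero h0 h1 hp he
    (measure_mono_null (fun ω hω => ?_) hzero)
  refine ⟨f [], fun hfin => ?_⟩
  have hreach : ∀ w : List (Fin (d - 1)), (∀ u ∈ nonemptySuffixes w, ω (e u) = true) →
      (openSubgraph G ω).Reachable (f []) (f w) := by
    intro w
    induction w with
    | nil => exact fun _ => .refl _
    | cons i w ih =>
      intro h
      refine (ih fun u hu => h u (Finset.mem_insert_of_mem hu)).trans
        (SimpleGraph.Adj.reachable (openSubgraph_adj.2 ⟨hadj i w, ?_⟩))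
      exact h _ (Finset.mem_insert_self _ _)
  have hfin' := (hfin.preimage hf.injOn).image List.length
  refine Set.infinite_univ (hfin'.subset fun n _ => ?_)
  obtain ⟨w, hw, h⟩ := hω n
  exact ⟨w, hreach w h, hw⟩

lemma one_lt_degree (hconn : G.Connected) (hinf : Infinite V)
    (hlf : ∀ v : V, (G.neighborSet v).Finite)
    (hreg : ∀ v : V, (G.neighborSet v).ncard = d) : 1 < d := by
  obtain ⟨v, b, l, hvb, hl, hnb, -⟩ := exists_nonBacktracking_nodup hconn hlf 1
  obtain ⟨c, rfl⟩ := List.length_eq_one_iff.1 hl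
  rw [← hreg b, Set.one_lt_ncard_iff (hlf b)]
  exact ⟨c, v, hnb.1, hvb.symm, hnb.2.1⟩

lemma le_pc (hconn : G.Connected) (hlf : ∀ v : V, (G.neighborSet v).Finite) {M K : ℕ}
    (hb : PathBound G M K) {p : ℝ} (h0 : 0 ≤ p) (h1 : p ≤ 1) (hp : K * p ^ M < 1) : p ≤ pc G :=
  le_csSup ⟨1, fun _ hx => hx.1.2⟩
    ⟨⟨h0, h1⟩, bernoulliProduct_hasInfiniteCluster_eq_zero hconn hlf hb h0 h1 hp⟩

/-- In a quasi-transitive regular graph with a cycle, paths are exponentially fewer than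
non-backtracking walks. -/
lemma exists_pathBound_lt (hconn : G.Connected) (hlf : ∀ v : V, (G.neighborSet v).Finite)
    (hreg : ∀ v : V, (G.neighborSet v).ncard = d) (hd : 1 < d) (hqt : QuasiTransitive G)
    (hcyc : ¬ G.IsAcyclic) : ∃ M, PathBound G M ((d - 1) ^ M - 1) := by
  obtain ⟨M, hM⟩ := exists_nonBacktracking_not_nodup hconn hqt (fun v => by rwa [hreg]) hcyc
  refine ⟨M, fun a b hab => ?_⟩
  obtain ⟨T, hT, hT'⟩ := exists_finset_nonBacktracking hlf hreg M hab
  obtain ⟨l₀, h1, h2, h3⟩ := hM a b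
  refine ⟨T.erase l₀, ?_, fun l hl hnb hnd => Finset.mem_erase.2 ⟨?_, hT' l hl hnb⟩⟩
  · rw [Finset.card_erase_of_mem (hT' l₀ h1 h2)]
    exact Nat.sub_le_sub_right hT 1
  · rintro rfl
    exact h3 hnd

lemma pc_le_of_isAcyclic (hacyc : G.IsAcyclic) (hlf : ∀ v : V, (G.neighborSet v).Finite)
    (hreg : ∀ v : V, (G.neighborSet v).ncard = d) (hd : 1 < d) (e₀ : G.Dart)
    (hne : ({p : ℝ | p ∈ Set.Icc (0 : ℝ) 1 ∧
      bernoulliProduct G.edgeSet p {ω | HasInfiniteCluster G ω} = 0}).Nonempty) :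
    pc G ≤ 1 / ((d - 1 : ℕ) : ℝ) := by
  refine csSup_le hne fun p hp => ?_
  by_contra! h
  have hb : 0 < ((d - 1 : ℕ) : ℝ) := by exact_mod_cast Nat.sub_pos_of_lt hd
  rw [div_lt_iff₀ hb, mul_comm] at h
  exact bernoulliProduct_hasInfiniteCluster_ne_zero hacyc hlf hreg e₀ hp.1.1 hp.1.2 h hp.2

lemma lt_pc_of_not_isAcyclic (hconn : G.Connected) (hinf : Infinite V)
    (hlf : ∀ v : V, (G.neighborSet v).Finite) (hreg : ∀ v : V, (G.neighborSet v).ncard = d)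
    (hd : 1 < d) (hqt : QuasiTransitive G) (hcyc : ¬ G.IsAcyclic) :
    1 / ((d - 1 : ℕ) : ℝ) < pc G := by
  obtain ⟨M, hM⟩ := exists_pathBound_lt hconn hlf hreg hd hqt hcyc
  have hd' : 1 < d - 1 := by
    by_contra! h
    obtain rfl : d = 2 := by omega
    obtain ⟨v, b, l, hvb, hl, hnb, hnd⟩ := exists_nonBacktracking_nodup hconn hlf M
    obtain ⟨T, hT, hT'⟩ := hM hvb
    have hT0 : T = ∅ := by simpa using hT
    simpa [hT0] using hT' l hl hnb hnd
  set b := d - 1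
  have hb : (1 : ℝ) < b := by exact_mod_cast hd'
  have hbM : ((b ^ M - 1 : ℕ) : ℝ) = (b : ℝ) ^ M - 1 := by
    rw [Nat.cast_sub (Nat.one_le_pow _ _ (by omega))]
    simp
  have hlt : ((b ^ M - 1 : ℕ) : ℝ) * (1 / b) ^ M < 1 := by
    have : (b : ℝ) ^ M ≠ 0 := by positivity
    rw [hbM, one_div, inv_pow, sub_mul, mul_inv_cancel₀ this]
    have : 0 < ((b : ℝ) ^ M)⁻¹ := by positivity
    linarith
  have hcont : Continuous fun p : ℝ => ((b ^ M - 1 : ℕ) : ℝ) * p ^ M := by fun_prop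
  have hev : ∀ᶠ p in nhdsWithin (1 / (b : ℝ)) (Set.Ioi (1 / b)),
      ((b ^ M - 1 : ℕ) : ℝ) * p ^ M < 1 :=
    nhdsWithin_le_nhds (hcont.continuousAt.eventually_lt_const hlt)
  have h1 : 1 / (b : ℝ) < 1 := by
    rw [div_lt_one (by linarith)]
    exact hb
  obtain ⟨p, hp, hp1, hp2⟩ := (hev.and (Ioo_mem_nhdsGT h1)).exists
  exact hp1.trans_le (le_pc hconn hlf hM
    ((one_div_nonneg.2 (by linarith)).trans hp1.le) hp2.le hp)

end Threshold

/-- Let `G` be a quasi-transitive `d`-regular locally finite, connected,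
infinite simple graph. Then `p_c(G) ≥ 1/(d-1)`, with equality iff `G` is a tree
(i.e. `G` contains no cycle). -/
theorem pc_ge_and_eq_iff_acyclic {V : Type*} (G : SimpleGraph V) (d : ℕ)
    (hconn : G.Connected) (hinf : Infinite V)
    (hlf : ∀ v : V, (G.neighborSet v).Finite)
    (hreg : ∀ v : V, (G.neighborSet v).ncard = d)
    (hqt : QuasiTransitive G) :
    1 / ((d : ℝ) - 1) ≤ pc G ∧ (pc G = 1 / ((d : ℝ) - 1) ↔ G.IsAcyclic) := by
  have hd := one_lt_degree hconn hinf hlf hreg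
  rw [show (d : ℝ) - 1 = ((d - 1 : ℕ) : ℝ) by rw [Nat.cast_sub hd.le, Nat.cast_one]]
  have hb : (1 : ℝ) ≤ ((d - 1 : ℕ) : ℝ) := by exact_mod_cast Nat.le_sub_one_of_lt hd
  have hpb : PathBound G 1 (d - 1) := fun a b hab => by
    obtain ⟨T, h1, h2⟩ := exists_finset_nonBacktracking hlf hreg 1 hab
    exact ⟨T, by simpa using h1, fun l hl hnb _ => h2 l hl hnb⟩
  have hge : 1 / ((d - 1 : ℕ) : ℝ) ≤ pc G := by
    refine le_of_forall_lt_imp_le_of_dense fun p hp => ?_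
    rcases lt_or_ge p 0 with h0 | h0
    · exact h0.le.trans (le_pc hconn hlf hpb le_rfl zero_le_one (by simp))
    · rw [lt_div_iff₀ (by linarith)] at hp
      exact le_pc hconn hlf hpb h0 (by nlinarith) (by rw [pow_one]; linarith)
  refine ⟨hge, fun heq => ?_, fun hacyc => le_antisymm ?_ hge⟩
  · by_contra hcyc
    exact (lt_pc_of_not_isAcyclic hconn hinf hlf hreg hd hqt hcyc).ne' heq
  · obtain ⟨v⟩ := hconn.nonempty
    obtain ⟨w, hw⟩ : (G.neighborSet v).Nonempty :=
      Set.nonempty_of_ncard_ne_zero (by rw [hreg]; omega)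
    exact pc_le_of_isAcyclic hacyc hlf hreg hd ⟨(v, w), hw⟩
      ⟨0, ⟨le_rfl, zero_le_one⟩, bernoulliProduct_hasInfiniteCluster_eq_zero hconn hlf hpb
        le_rfl zero_le_one (by simp)⟩
end

section
/- Let G be a quasi-transitive d-regular locally finite, connected, infinite simple graph that contains at least one cycle. Then p_c(G) > 1/(d-1). -/
open MeasureTheory
open scoped Classical ENNReal

open Filter Topology

namespace SimpleGraph

variable {V : Type*} {G : SimpleGraph V}

/-- `G.IsNonBacktracking x y l`: the vertex list `l` continues a walk that has just traversed the
edge from `x` to `y` and never immediately reverses an edge. -/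
def IsNonBacktracking (G : SimpleGraph V) : V → V → List V → Prop
  | _, _, [] => True
  | x, y, z :: l => G.Adj y z ∧ z ≠ x ∧ G.IsNonBacktracking y z l

/-- Some non-backtracking continuation of length `n` of the directed edge `(x, y)` revisits a
vertex. -/
def Revisits (G : SimpleGraph V) (n : ℕ) (x y : V) : Prop :=
  ∃ l : List V, l.length = n ∧ G.IsNonBacktracking x y l ∧ ¬ (x :: y :: l).Nodup

/-- The last two vertices of the list `x :: y :: l`. -/
def lastEdge : V → V → List V → V × V
  | x, y, [] => (x, y)
  | _, y, z :: l => lastEdge y z l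

theorem isNonBacktracking_append {x y : V} {l₁ l₂ : List V} :
    G.IsNonBacktracking x y (l₁ ++ l₂) ↔ G.IsNonBacktracking x y l₁ ∧
      G.IsNonBacktracking (lastEdge x y l₁).1 (lastEdge x y l₁).2 l₂ := by
  induction l₁ generalizing x y with
  | nil => simp [IsNonBacktracking, lastEdge]
  | cons z l ih => simp [IsNonBacktracking, lastEdge, ih, and_assoc]

theorem adj_lastEdge {x y : V} {l : List V} (hxy : G.Adj x y)
    (h : G.IsNonBacktracking x y l) : G.Adj (lastEdge x y l).1 (lastEdge x y l).2 := by
  induction l generalizing x y with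
  | nil => exact hxy
  | cons z l ih => exact ih h.1 h.2.2

theorem nodup_lastEdge {x y : V} {l₁ l₂ : List V} (h : (x :: y :: (l₁ ++ l₂)).Nodup) :
    ((lastEdge x y l₁).1 :: (lastEdge x y l₁).2 :: l₂).Nodup := by
  induction l₁ generalizing x y with
  | nil => exact h
  | cons z l ih => exact ih (List.nodup_cons.1 h).2

theorem isNonBacktracking_of_nodup {x y : V} {l : List V}
    (hc : List.IsChain G.Adj (x :: y :: l)) (hn : (x :: y :: l).Nodup) :
    G.IsNonBacktracking x y l := by
  induction l generalizing x y with
  | nil => trivial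
  | cons z l ih =>
    rw [List.isChain_cons_cons] at hc
    refine ⟨(List.isChain_cons_cons.1 hc.2).1, ?_, ih hc.2 (List.nodup_cons.1 hn).2⟩
    rintro rfl
    simp at hn

theorem IsNonBacktracking.map_iso {x y : V} {l : List V} (φ : G ≃g G)
    (h : G.IsNonBacktracking x y l) : G.IsNonBacktracking (φ x) (φ y) (l.map φ) := by
  induction l generalizing x y with
  | nil => trivial
  | cons z l ih => exact ⟨φ.map_adj_iff.2 h.1, φ.injective.ne h.2.1, ih h.2.2⟩

theorem Revisits.map_iso {n : ℕ} {x y : V} (φ : G ≃g G) (h : G.Revisits n x y) :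
    G.Revisits n (φ x) (φ y) := by
  obtain ⟨l, hl, hb, hn⟩ := h
  refine ⟨l.map φ, by simpa using hl, hb.map_iso φ, fun h => hn ?_⟩
  rw [← List.map_cons, ← List.map_cons] at h
  exact h.of_map

theorem Revisits.cons {n : ℕ} {x y z : V} (hyz : G.Adj y z) (hzx : z ≠ x)
    (h : G.Revisits n y z) : G.Revisits (n + 1) x y := by
  obtain ⟨l, hl, hb, hn⟩ := h
  exact ⟨z :: l, by simp [hl], ⟨hyz, hzx, hb⟩, fun h => hn (List.nodup_cons.1 h).2⟩

theorem Revisits.mono {m n : ℕ} {x y : V} (hext : ∀ a b : V, G.Adj a b → ∃ z, G.Adj b z ∧ z ≠ a)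
    (hxy : G.Adj x y) (hmn : m ≤ n) (h : G.Revisits m x y) : G.Revisits n x y := by
  induction n, hmn using Nat.le_induction with
  | base => exact h
  | succ n _ ih =>
    obtain ⟨l, hl, hb, hn⟩ := ih
    obtain ⟨z, hz, hza⟩ := hext _ _ (adj_lastEdge hxy hb)
    refine ⟨l ++ [z], by simp [hl], isNonBacktracking_append.2 ⟨hb, hz, hza, trivial⟩, ?_⟩
    rw [← List.cons_append, ← List.cons_append]
    exact fun h => hn h.of_append_left

/-- If non-backtracking walks can be continued forever inside a finite vertex set, they revisit
a vertex. -/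
theorem exists_revisits_of_forall_exists_adj (Q : Set (V × V)) (X : Finset V)
    (hQ : ∀ s ∈ Q, ∃ z ∈ X, G.Adj s.2 z ∧ z ≠ s.1 ∧ (s.2, z) ∈ Q) {x y : V}
    (hxy : (x, y) ∈ Q) : ∃ n, G.Revisits n x y := by
  have key : ∀ n, ∀ s ∈ Q, ∃ l : List V, l.length = n ∧ G.IsNonBacktracking s.1 s.2 l ∧
      ∀ z ∈ l, z ∈ X := by
    intro n
    induction n with
    | zero => exact fun s _ => ⟨[], rfl, trivial, by simp⟩
    | succ n ih =>
      intro s hs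
      obtain ⟨z, hzX, hz, hzs, hzQ⟩ := hQ s hs
      obtain ⟨l, hl, hb, hX⟩ := ih _ hzQ
      exact ⟨z :: l, by simp [hl], ⟨hz, hzs, hb⟩, by simpa using ⟨hzX, hX⟩⟩
  obtain ⟨l, hl, hb, hX⟩ := key (X.card + 1) _ hxy
  refine ⟨_, l, hl, hb, fun hn => ?_⟩
  have hln : l.Nodup := (List.nodup_cons.1 (List.nodup_cons.1 hn).2).2
  have := Finset.card_le_card (s := l.toFinset) (t := X) fun z hz => hX z (by simpa using hz)
  rw [List.toFinset_card_of_nodup hln] at this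
  omega

theorem Walk.IsCycle.exists_adj_ne {c w : V} {C : G.Walk c c} (hC : C.IsCycle)
    (hw : w ∈ C.support) (a : V) : ∃ z ∈ C.support, G.Adj w z ∧ z ≠ a := by
  have hR := hC.rotate hw
  have hmem : ∀ z ∈ (C.rotate w hw).support, z ∈ C.support := fun z hz => by
    simpa using hz
  by_cases h : (C.rotate w hw).snd = a
  · refine ⟨(C.rotate w hw).penultimate, hmem _ (Walk.getVert_mem_support _ _), ?_, ?_⟩
    · exact (Walk.adj_penultimate hR.not_nil).symm
    · rw [← h]; exact hR.snd_ne_penultimate.symm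
  · exact ⟨_, hmem _ (Walk.getVert_mem_support _ _), Walk.adj_snd hR.not_nil, h⟩

theorem Walk.IsCycle.exists_revisits {c : V} {C : G.Walk c c} (hC : C.IsCycle) (a : V) :
    ∃ n, G.Revisits n a c := by
  refine exists_revisits_of_forall_exists_adj {s | s.2 ∈ C.support} C.support.toFinset ?_
    C.start_mem_support
  intro s hs
  obtain ⟨z, hz, h, hne⟩ := hC.exists_adj_ne hs s.1
  exact ⟨z, by simpa using hz, h, hne, hz⟩

theorem finite_setOf_walk_length_le (hG : ∀ v, (G.neighborSet v).Finite) (n : ℕ) (v : V) :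
    {w | ∃ p : G.Walk v w, p.length ≤ n}.Finite := by
  induction n generalizing v with
  | zero =>
    refine (Set.finite_singleton v).subset ?_
    rintro w ⟨p, hp⟩
    exact (Walk.eq_of_length_eq_zero (Nat.le_zero.1 hp)).symm
  | succ n ih =>
    refine (((hG v).biUnion fun z _ => ih z).insert v).subset ?_
    rintro w ⟨p, hp⟩
    cases p with
    | nil => exact Or.inl rfl
    | cons h p =>
      refine Or.inr (Set.mem_biUnion (x := _) h ⟨p, ?_⟩)
      simpa using hp

theorem Connected.countable (hconn : G.Connected) (hG : ∀ v, (G.neighborSet v).Finite) :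
    Countable V := by
  obtain ⟨v⟩ := hconn.nonempty
  rw [← Set.countable_univ_iff]
  refine (Set.countable_iUnion fun n =>
    (finite_setOf_walk_length_le hG n v).countable).mono fun w _ => ?_
  obtain ⟨p⟩ := hconn.preconnected v w
  exact Set.mem_iUnion.2 ⟨p.length, p, le_rfl⟩

theorem exists_nodup_chain_of_infinite (hG : ∀ v, (G.neighborSet v).Finite) {v : V}
    (hv : {w | G.Reachable v w}.Infinite) (n : ℕ) :
    ∃ l : List V, l.length = n ∧ List.IsChain G.Adj (v :: l) ∧ (v :: l).Nodup := by
  obtain ⟨w, ⟨p⟩, hwn⟩ := (hv.sdiff (finite_setOf_walk_length_le hG n v)).nonempty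
  have hq : n < p.bypass.length := by
    by_contra! h
    exact hwn ⟨_, h⟩
  have hs : v :: p.bypass.support.tail = p.bypass.support := p.bypass.cons_tail_support
  refine ⟨p.bypass.support.tail.take n, ?_, ?_, ?_⟩
  · simp; omega
  · have := p.bypass.isChain_adj_support.take (n + 1)
    rwa [← hs, List.take_succ_cons] at this
  · have := p.bypass_isPath.support_nodup.sublist (List.take_sublist (n + 1) _)
    rwa [← hs, List.take_succ_cons] at this

/-- If every vertex is at bounded distance from a vertex all of whose incoming edges have a
revisiting non-backtracking continuation, then all edges have such a continuation. -/
theorem exists_revisits_of_walk_length_le (hG : ∀ v, (G.neighborSet v).Finite)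
    (hext : ∀ a b : V, G.Adj a b → ∃ z, G.Adj b z ∧ z ≠ a) (R : ℕ)
    (hR : ∀ w, ∃ c, (∃ p : G.Walk w c, p.length ≤ R) ∧ ∀ a, ∃ n, G.Revisits n a c)
    {u v : V} (huv : G.Adj u v) : ∃ n, G.Revisits n u v := by
  by_contra hbad
  let step (s t : V × V) : Prop := t.1 = s.2 ∧ G.Adj s.2 t.2 ∧ t.2 ≠ s.1
  let Q : Set (V × V) := {s | Relation.ReflTransGen step (u, v) s}
  have hQbad : ∀ s ∈ Q, ¬ ∃ n, G.Revisits n s.1 s.2 := by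
    intro s hs
    induction hs with
    | refl => exact hbad
    | @tail s t _ hst ih =>
      rintro ⟨n, h⟩
      obtain ⟨h1, h2, h3⟩ := hst
      rw [h1] at h
      exact ih ⟨_, h.cons h2 h3⟩
  have hQadj : ∀ s ∈ Q, G.Adj s.1 s.2 := by
    intro s hs
    induction hs with
    | refl => exact huv
    | tail _ hst _ => rw [hst.1]; exact hst.2.1
  have hclosed : ∀ s ∈ Q, ∀ z, G.Adj s.2 z → z = u ∨ ∃ t ∈ Q, t.2 = z := by
    intro s hs z hz
    by_cases hzs : z = s.1
    · rcases Relation.ReflTransGen.cases_tail hs with h | ⟨t, ht, hts⟩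
      · left; rw [hzs, h]
      · exact Or.inr ⟨t, ht, by rw [hzs, hts.1]⟩
    · exact Or.inr ⟨(s.2, z), Relation.ReflTransGen.tail hs ⟨rfl, hz, hzs⟩, rfl⟩
  have hwalk : ∀ (w c : V) (p : G.Walk w c), (∃ s ∈ Q, s.2 = w) →
      (∃ s ∈ Q, s.2 = c) ∨ ∃ q : G.Walk w u, q.length ≤ p.length := by
    intro w c p
    induction p with
    | nil => exact fun h => Or.inl h
    | @cons a b c h p ih =>
      rintro ⟨s, hs, rfl⟩
      rcases hclosed s hs _ h with rfl | ht
      · exact Or.inr ⟨.cons h .nil, by simp⟩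
      · rcases ih ht with hc | ⟨q, hq⟩
        · exact Or.inl hc
        · exact Or.inr ⟨.cons h q, by simpa using hq⟩
  have hfin := finite_setOf_walk_length_le hG R u
  refine hbad (exists_revisits_of_forall_exists_adj Q hfin.toFinset ?_ Relation.ReflTransGen.refl)
  intro s hs
  obtain ⟨z, hz, hzs⟩ := hext _ _ (hQadj s hs)
  have hzQ : (s.2, z) ∈ Q := Relation.ReflTransGen.tail hs ⟨rfl, hz, hzs⟩
  refine ⟨z, ?_, hz, hzs, hzQ⟩
  obtain ⟨c, ⟨p, hp⟩, hc⟩ := hR z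
  rcases hwalk z c p ⟨_, hzQ, rfl⟩ with ⟨t, ht, rfl⟩ | ⟨q, hq⟩
  · exact absurd (hc t.1) (hQbad t ht)
  · simpa using ⟨q.reverse, by simpa using hq.trans hp⟩

theorem _root_.QuasiTransitive.exists_forall_revisits (hqt : QuasiTransitive G)
    (hconn : G.Connected) (hG : ∀ v, (G.neighborSet v).Finite)
    (hext : ∀ a b : V, G.Adj a b → ∃ z, G.Adj b z ∧ z ≠ a) (hcyc : ¬ G.IsAcyclic) :
    ∃ n, 0 < n ∧ ∀ x y, G.Adj x y → G.Revisits n x y := by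
  obtain ⟨S, hS⟩ := hqt
  simp only [IsAcyclic, not_forall, not_not] at hcyc
  obtain ⟨c, C, hC⟩ := hcyc
  have hpath (s : V) : ∃ p : G.Walk s c, True := ⟨(hconn.preconnected s c).some, trivial⟩
  choose p _ using hpath
  have hedge : ∀ x y, G.Adj x y → ∃ n, G.Revisits n x y := by
    intro x y hxy
    refine exists_revisits_of_walk_length_le hG hext (S.sup fun s => (p s).length) ?_ hxy
    intro w
    obtain ⟨φ, hφ⟩ := hS w
    refine ⟨φ.symm c, ⟨((p (φ w)).map φ.symm.toHom).copy (by simp) rfl, ?_⟩, fun a => ?_⟩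
    · simpa using Finset.le_sup (f := fun s => (p s).length) hφ
    · obtain ⟨n, h⟩ := hC.exists_revisits (φ a)
      exact ⟨n, by simpa using h.map_iso φ.symm⟩
  choose f hf using hedge
  let g (e : V × V) : ℕ := if h : G.Adj e.1 e.2 then f e.1 e.2 h else 0
  let E : Finset (V × V) := S.biUnion fun s => (hG s).toFinset.image fun t => (s, t)
  refine ⟨E.sup g + 1, Nat.succ_pos _, fun x y hxy => ?_⟩
  obtain ⟨φ, hφ⟩ := hS x
  have hadj : G.Adj (φ x) (φ y) := φ.map_adj_iff.2 hxy
  have hE : (φ x, φ y) ∈ E := by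
    simp only [E, Finset.mem_biUnion, Finset.mem_image]
    exact ⟨φ x, hφ, φ y, by simpa using hadj, rfl⟩
  have hle : f (φ x) (φ y) hadj ≤ E.sup g := by
    simpa [g, hadj] using Finset.le_sup (f := g) hE
  simpa using ((hf _ _ hadj).mono hext hadj (hle.trans (Nat.le_succ _))).map_iso φ.symm

section Counting

variable [G.LocallyFinite]

/-- The non-backtracking continuations of length `n` of a directed edge. -/
noncomputable def nonBacktrackingLists (G : SimpleGraph V) [G.LocallyFinite] :
    V → V → ℕ → Finset (List V)
  | _, _, 0 => {[]}
  | x, y, n + 1 => ((G.neighborFinset y).erase x).biUnion fun z =>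
      (G.nonBacktrackingLists y z n).image (List.cons z)

theorem mem_nonBacktrackingLists {x y : V} {n : ℕ} {l : List V} :
    l ∈ G.nonBacktrackingLists x y n ↔ l.length = n ∧ G.IsNonBacktracking x y l := by
  induction n generalizing x y l with
  | zero => cases l <;> simp [nonBacktrackingLists, IsNonBacktracking]
  | succ n ih =>
    cases l with
    | nil => simp [nonBacktrackingLists]
    | cons z l => simp [nonBacktrackingLists, IsNonBacktracking, ih]; tauto

theorem IsRegularOfDegree.card_nonBacktrackingLists_le {d : ℕ} (hreg : G.IsRegularOfDegree d)
    {x y : V} (hxy : G.Adj x y) (n : ℕ) :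
    (G.nonBacktrackingLists x y n).card ≤ (d - 1) ^ n := by
  induction n generalizing x y with
  | zero => simp [nonBacktrackingLists]
  | succ n ih =>
    have hcard : ((G.neighborFinset y).erase x).card = d - 1 := by
      rw [Finset.card_erase_of_mem (by simpa using hxy.symm), card_neighborFinset_eq_degree, hreg y]
    calc _ ≤ ∑ z ∈ (G.neighborFinset y).erase x,
          ((G.nonBacktrackingLists y z n).image (List.cons z)).card := Finset.card_biUnion_le
      _ ≤ ∑ z ∈ (G.neighborFinset y).erase x, (d - 1) ^ n := by
          refine Finset.sum_le_sum fun z hz => Finset.card_image_le.trans (ih ?_)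
          simpa using Finset.mem_of_mem_erase hz
      _ = (d - 1) ^ (n + 1) := by rw [Finset.sum_const, hcard, smul_eq_mul, pow_succ']

/-- The self-avoiding continuations of length `n` of a directed edge. -/
noncomputable def selfAvoidingLists (G : SimpleGraph V) [G.LocallyFinite] (x y : V) (n : ℕ) :
    Finset (List V) :=
  (G.nonBacktrackingLists x y n).filter fun l => (x :: y :: l).Nodup

theorem mem_selfAvoidingLists {x y : V} {n : ℕ} {l : List V} :
    l ∈ G.selfAvoidingLists x y n ↔
      l.length = n ∧ G.IsNonBacktracking x y l ∧ (x :: y :: l).Nodup := by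
  simp [selfAvoidingLists, mem_nonBacktrackingLists, and_assoc]

theorem IsRegularOfDegree.card_selfAvoidingLists_le {d : ℕ} (hreg : G.IsRegularOfDegree d)
    {x y : V} (hxy : G.Adj x y) {n : ℕ} (h : G.Revisits n x y) :
    (G.selfAvoidingLists x y n).card ≤ (d - 1) ^ n - 1 := by
  obtain ⟨l, hl, hb, hn⟩ := h
  refine Nat.le_sub_one_of_lt (lt_of_lt_of_le (Finset.card_lt_card ?_)
    (hreg.card_nonBacktrackingLists_le hxy n))
  exact Finset.filter_ssubset.2 ⟨l, mem_nonBacktrackingLists.2 ⟨hl, hb⟩, hn⟩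

theorem card_selfAvoidingLists_mul_le {k M : ℕ}
    (hM : ∀ x y, G.Adj x y → (G.selfAvoidingLists x y k).card ≤ M) (m : ℕ) {x y : V}
    (hxy : G.Adj x y) : (G.selfAvoidingLists x y (m * k)).card ≤ M ^ m := by
  induction m generalizing x y with
  | zero =>
    rw [zero_mul, pow_zero]
    exact (Finset.card_filter_le _ _).trans (by simp [nonBacktrackingLists])
  | succ m ih =>
    let T (l : List V) := (G.selfAvoidingLists (lastEdge x y l).1 (lastEdge x y l).2 (m * k))
    have hsub : G.selfAvoidingLists x y ((m + 1) * k) ⊆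
        (G.selfAvoidingLists x y k).biUnion fun l => (T l).image (l ++ ·) := by
      intro l hl
      obtain ⟨hlen, hb, hn⟩ := mem_selfAvoidingLists.1 hl
      have hlen' : l.length = k + m * k := by rw [hlen]; ring
      rw [← List.take_append_drop k l] at hb hn
      obtain ⟨hb₁, hb₂⟩ := isNonBacktracking_append.1 hb
      simp only [Finset.mem_biUnion, Finset.mem_image]
      refine ⟨l.take k, mem_selfAvoidingLists.2 ⟨by simp [hlen'], hb₁, ?_⟩, l.drop k,
        mem_selfAvoidingLists.2 ⟨by simp [hlen'], hb₂, nodup_lastEdge hn⟩,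
        List.take_append_drop k l⟩
      rw [← List.cons_append, ← List.cons_append] at hn
      exact hn.of_append_left
    calc _ ≤ _ := Finset.card_le_card hsub
      _ ≤ ∑ l ∈ G.selfAvoidingLists x y k, ((T l).image (l ++ ·)).card := Finset.card_biUnion_le
      _ ≤ ∑ l ∈ G.selfAvoidingLists x y k, M ^ m := by
          refine Finset.sum_le_sum fun l hl => Finset.card_image_le.trans (ih ?_)
          exact adj_lastEdge hxy (mem_selfAvoidingLists.1 hl).2.1
      _ ≤ M ^ (m + 1) := by
          rw [Finset.sum_const, smul_eq_mul, pow_succ']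
          exact Nat.mul_le_mul_right _ (hM x y hxy)

end Counting

end SimpleGraph

theorem bernoulliMeasure_le_one {p : ℝ} (hp : p ∈ Set.Icc (0 : ℝ) 1) (s : Set Bool) :
    bernoulliMeasure p s ≤ 1 := by
  refine (measure_mono (Set.subset_univ s)).trans ?_
  simp [bernoulliMeasure, ← ENNReal.ofReal_add hp.1 (sub_nonneg.2 hp.2)]

theorem bernoulliProduct_setOf_forall_eq_true_le {ι : Type*} {p : ℝ} (hp : p ∈ Set.Icc (0 : ℝ) 1)
    (F : Finset ι) :
    bernoulliProduct ι p {ω | ∀ i ∈ F, ω i = true} ≤ ENNReal.ofReal p ^ F.card := by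
  refine (OuterMeasure.ofFunction_le _).trans ?_
  split_ifs
  · exact zero_le
  set f : ι → ℝ≥0∞ := fun i =>
    bernoulliMeasure p (Function.eval i '' {ω : ι → Bool | ∀ i ∈ F, ω i = true})
  have hf1 : ∀ i, f i ≤ 1 := fun i => bernoulliMeasure_le_one hp _
  have hglb := hasProd_of_isGLB_of_le_one _ hf1 (isGLB_sInf _)
  rw [hglb.tprod_eq]
  refine (sInf_le (Set.mem_range_self F)).trans ?_
  rw [← Finset.prod_const]
  refine Finset.prod_le_prod' fun i hi => ?_
  have hsub : Function.eval i '' {ω : ι → Bool | ∀ i ∈ F, ω i = true} ⊆ {true} := by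
    rintro _ ⟨ω, hω, rfl⟩
    exact hω i hi
  refine (measure_mono hsub).trans ?_
  simp [bernoulliMeasure]

/-- The probability that a given self-avoiding walk of length `n` is open is at most `p ^ n`. -/
theorem bernoulliProduct_setOf_isChain_le {V : Type*} {G : SimpleGraph V} {p : ℝ}
    (hp : p ∈ Set.Icc (0 : ℝ) 1) {x : V} {l : List V} (hn : (x :: l).Nodup) :
    bernoulliProduct G.edgeSet p {ω | List.IsChain (openSubgraph G ω).Adj (x :: l)} ≤
      ENNReal.ofReal p ^ l.length := by
  by_cases hc : List.IsChain G.Adj (x :: l)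
  · obtain ⟨F, hF, -, hopen⟩ : ∃ F : Finset G.edgeSet, F.card = l.length ∧
        (∀ e ∈ F, ∀ v ∈ e.1, v ∈ x :: l) ∧
        ∀ ω, List.IsChain (openSubgraph G ω).Adj (x :: l) → ∀ e ∈ F, ω e = true := by
      induction l generalizing x with
      | nil => exact ⟨∅, by simp⟩
      | cons y l ih =>
        obtain ⟨hxy, hc⟩ := List.isChain_cons_cons.1 hc
        obtain ⟨hx, hn⟩ := List.nodup_cons.1 hn
        obtain ⟨F, hF, hmem, hopen⟩ := ih hn hc
        have hnot : (⟨s(x, y), hxy⟩ : G.edgeSet) ∉ F := fun h => hx (hmem _ h x (by simp))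
        refine ⟨insert ⟨s(x, y), hxy⟩ F, by simp [hnot, hF], ?_, ?_⟩
        · intro e he v hv
          rcases Finset.mem_insert.1 he with rfl | he
          · rcases Sym2.mem_iff.1 hv with rfl | rfl <;> simp
          · exact List.mem_cons_of_mem _ (hmem e he v hv)
        · intro ω hω e he
          obtain ⟨hω₁, hω₂⟩ := List.isChain_cons_cons.1 hω
          rcases Finset.mem_insert.1 he with rfl | he
          · simp only [openSubgraph, SimpleGraph.deleteEdges_adj, Set.mem_ofPred_eq,
              not_exists, Bool.not_eq_false] at hω₁
            exact hω₁.2 hxy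
          · exact hopen ω hω₂ e he
    rw [← hF]
    exact (measure_mono hopen).trans (bernoulliProduct_setOf_forall_eq_true_le hp F)
  · have : {ω | List.IsChain (openSubgraph G ω).Adj (x :: l)} = ∅ := by
      refine Set.eq_empty_of_forall_notMem fun ω hω => hc (hω.imp fun a b h => ?_)
      exact G.deleteEdges_le _ h
    simp [this]

open SimpleGraph in
theorem bernoulliProduct_hasInfiniteCluster_eq_zero_s1 {V : Type*} {G : SimpleGraph V}
    [G.LocallyFinite] (hconn : G.Connected) {p : ℝ} (hp : p ∈ Set.Icc (0 : ℝ) 1) {k M : ℕ}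
    (hM : ∀ x y, G.Adj x y → (G.selfAvoidingLists x y k).card ≤ M) (hMp : M * p ^ k < 1) :
    bernoulliProduct G.edgeSet p {ω | HasInfiniteCluster G ω} = 0 := by
  have hG : ∀ v, (G.neighborSet v).Finite := fun v => Set.toFinite _
  have := hconn.countable hG
  have hset : {ω | HasInfiniteCluster G ω} =
      ⋃ v, {ω | {w : V | (openSubgraph G ω).Reachable v w}.Infinite} := by
    ext ω; simp [HasInfiniteCluster]
  rw [hset, measure_iUnion_null_iff]
  intro v
  have hle (ω) : openSubgraph G ω ≤ G := G.deleteEdges_le _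
  have hbound (m : ℕ) : bernoulliProduct G.edgeSet p
      {ω | {w : V | (openSubgraph G ω).Reachable v w}.Infinite} ≤
        ENNReal.ofReal (G.degree v * (M * p ^ k) ^ m) := by
    have hsub : {ω | {w : V | (openSubgraph G ω).Reachable v w}.Infinite} ⊆
        ⋃ y ∈ G.neighborFinset v, ⋃ l ∈ G.selfAvoidingLists v y (m * k),
          {ω | List.IsChain (openSubgraph G ω).Adj (y :: l)} := by
      intro ω hω
      obtain ⟨l, hl, hc, hn⟩ := exists_nodup_chain_of_infinite
        (fun w => (hG w).subset (neighborSet_mono (hle ω) w)) hω (m * k + 1)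
      obtain ⟨y, l, rfl⟩ := List.exists_cons_of_length_eq_add_one hl
      have hcG : List.IsChain G.Adj (v :: y :: l) := hc.imp fun a b h => hle ω h
      simp only [Set.mem_iUnion]
      exact ⟨y, by simpa using (List.isChain_cons_cons.1 hcG).1, l,
        mem_selfAvoidingLists.2 ⟨by simpa using hl, isNonBacktracking_of_nodup hcG hn, hn⟩,
        (List.isChain_cons_cons.1 hc).2⟩
    calc _ ≤ _ := measure_mono hsub
      _ ≤ ∑ y ∈ G.neighborFinset v, ∑ l ∈ G.selfAvoidingLists v y (m * k),
          ENNReal.ofReal p ^ (m * k) := by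
        refine (measure_biUnion_finset_le _ _).trans (Finset.sum_le_sum fun y _ =>
          (measure_biUnion_finset_le _ _).trans (Finset.sum_le_sum fun l hl => ?_))
        obtain ⟨hl, -, hn⟩ := mem_selfAvoidingLists.1 hl
        rw [← hl]
        exact bernoulliProduct_setOf_isChain_le hp (List.nodup_cons.1 hn).2
      _ ≤ ∑ y ∈ G.neighborFinset v, (M ^ m : ℕ) * ENNReal.ofReal p ^ (m * k) := by
        refine Finset.sum_le_sum fun y hy => ?_
        rw [Finset.sum_const, nsmul_eq_mul]
        gcongr
        exact card_selfAvoidingLists_mul_le hM m (by simpa using hy)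
      _ = _ := by
        rw [Finset.sum_const, nsmul_eq_mul, card_neighborFinset_eq_degree,
          ENNReal.ofReal_mul (by positivity), mul_pow, ENNReal.ofReal_mul (by positivity),
          ENNReal.ofReal_natCast, ← Nat.cast_pow, ENNReal.ofReal_natCast, ← pow_mul, mul_comm k,
          ENNReal.ofReal_pow hp.1]
  have hnonneg : 0 ≤ M * p ^ k := mul_nonneg (Nat.cast_nonneg _) (pow_nonneg hp.1 _)
  have hlim : Tendsto (fun m : ℕ => ENNReal.ofReal (G.degree v * (M * p ^ k) ^ m)) atTop (𝓝 0) := by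
    simpa using ENNReal.tendsto_ofReal
      ((tendsto_pow_atTop_nhds_zero_of_lt_one hnonneg hMp).const_mul (G.degree v : ℝ))
  exact le_antisymm (ge_of_tendsto' hlim hbound) zero_le

/-- A quasi-transitive `d`-regular locally finite, connected, infinite
simple graph containing a cycle satisfies `p_c(G) > 1/(d-1)`. -/
theorem pc_gt_of_not_acyclic {V : Type*} (G : SimpleGraph V) (d : ℕ)
    (hconn : G.Connected) (hinf : Infinite V)
    (hlf : ∀ v : V, (G.neighborSet v).Finite)
    (hreg : ∀ v : V, (G.neighborSet v).ncard = d)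
    (hqt : QuasiTransitive G) (hcyc : ¬ G.IsAcyclic) :
    1 / ((d : ℝ) - 1) < pc G := by
  have : G.LocallyFinite := fun v => (hlf v).fintype
  have hreg' : G.IsRegularOfDegree d := fun v => by
    rw [← hreg v, ← G.card_neighborSet_eq_degree, Set.ncard_eq_toFinset_card', Set.toFinset_card]
  have hd : 2 ≤ d := by
    simp only [SimpleGraph.IsAcyclic, not_forall, not_not] at hcyc
    obtain ⟨c, C, hC⟩ := hcyc
    obtain ⟨z, -, hz, hzc⟩ := hC.exists_adj_ne C.start_mem_support c
    obtain ⟨z', -, hz', hne⟩ := hC.exists_adj_ne C.start_mem_support z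
    rw [← hreg' c, ← G.card_neighborFinset_eq_degree]
    exact Finset.one_lt_card.2 ⟨z, by simpa using hz, z', by simpa using hz', hne.symm⟩
  have hext : ∀ a b : V, G.Adj a b → ∃ z, G.Adj b z ∧ z ≠ a := by
    intro a b _
    have : 1 < (G.neighborFinset b).card := by
      rw [G.card_neighborFinset_eq_degree, hreg' b]; omega
    obtain ⟨z, hz, hza⟩ := Finset.exists_mem_ne this a
    exact ⟨z, by simpa using hz, hza⟩
  obtain ⟨k, hk, hrev⟩ := hqt.exists_forall_revisits hconn hlf hext hcyc
  have hM : ∀ x y, G.Adj x y → (G.selfAvoidingLists x y k).card ≤ (d - 1) ^ k - 1 :=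
    fun x y hxy => hreg'.card_selfAvoidingLists_le hxy (hrev x y hxy)
  have hd3 : 3 ≤ d := by
    by_contra hlt
    obtain rfl : d = 2 := by omega
    obtain ⟨v⟩ := hconn.nonempty
    have hv : {w | G.Reachable v w}.Infinite := by
      rw [Set.eq_univ_of_forall (s := {w | G.Reachable v w}) (hconn.preconnected v)]
      exact Set.infinite_univ
    obtain ⟨l, hl, hc, hn⟩ := SimpleGraph.exists_nodup_chain_of_infinite hlf hv (k + 1)
    obtain ⟨y, l, rfl⟩ := List.exists_cons_of_length_eq_add_one hl
    have hcard := hM v y (List.isChain_cons_cons.1 hc).1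
    simp only [Nat.add_one_sub_one, one_pow, Nat.sub_self, Nat.le_zero, Finset.card_eq_zero]
      at hcard
    have hmem : l ∈ G.selfAvoidingLists v y k := SimpleGraph.mem_selfAvoidingLists.2
      ⟨by simpa using hl, SimpleGraph.isNonBacktracking_of_nodup hc hn, hn⟩
    simp [hcard] at hmem
  have hD : (1 : ℝ) < d - 1 := by
    have : (3 : ℝ) ≤ d := by exact_mod_cast hd3
    linarith
  have hMD : (((d - 1) ^ k - 1 : ℕ) : ℝ) * (1 / ((d : ℝ) - 1)) ^ k < 1 := by
    rw [Nat.cast_sub (Nat.one_le_pow _ _ (by omega)), Nat.cast_pow, Nat.cast_sub (by omega),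
      Nat.cast_one, div_pow, one_pow, mul_one_div, div_lt_one (by positivity)]
    linarith
  have hcont : ContinuousAt (fun p : ℝ => (((d - 1) ^ k - 1 : ℕ) : ℝ) * p ^ k)
      (1 / ((d : ℝ) - 1)) := by fun_prop
  have hlt1 : 1 / ((d : ℝ) - 1) < 1 := by rw [div_lt_one (by linarith)]; exact hD
  obtain ⟨p, ⟨hp, hp1⟩, hlt⟩ := (((hcont.eventually_lt_const hMD).and
    (eventually_lt_nhds hlt1)).filter_mono nhdsWithin_le_nhds |>.and
    (self_mem_nhdsWithin (s := Set.Ioi (1 / ((d : ℝ) - 1))))).exists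
  have hp0 : p ∈ Set.Icc (0 : ℝ) 1 := ⟨(lt_trans (by positivity) hlt).le, hp1.le⟩
  refine lt_of_lt_of_le hlt (le_csSup ⟨1, fun q hq => hq.1.2⟩ ⟨hp0, ?_⟩)
  exact bernoulliProduct_hasInfiniteCluster_eq_zero_s1 hconn hp0 hM hp
end
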